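/- Let x̄ ∈ Ω, let the family {g_t}_{t∈T} be uniformly Fréchet differentiable at x̄, and suppose that both the PMFCQ and the NFMCQ hold at x̄. Then the Fréchet normal cone is computed without closure: N̂(x̄; Ω) = cone{∇g_t(x̄) : t ∈ T(x̄)} + ∇h(x̄)*(Y*). -/

import Mathlib

open Filter Topology Set Pointwise

section Defs

variable {X : Type*} [NormedAddCommGroup X] [NormedSpace ℝ X]

/-- The canonical identification of the dual of `X` with its weak* dual. -/
def toWD (p : X →L[ℝ] ℝ) : WeakDual ℝ X := p

/-- The weak* closure of a subset of the dual. -/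
def wkClosure (S : Set (X →L[ℝ] ℝ)) : Set (X →L[ℝ] ℝ) :=
  {p | toWD p ∈ closure (toWD '' S)}

/-- A subset of the dual is weak* closed. -/
def IsWeakStarClosed (S : Set (X →L[ℝ] ℝ)) : Prop :=
  IsClosed (toWD '' S)

/-- A subset of `X* × ℝ` is weak* closed. -/
def IsWeakStarClosedProd (S : Set ((X →L[ℝ] ℝ) × ℝ)) : Prop :=
  IsClosed ((fun p : (X →L[ℝ] ℝ) × ℝ => (toWD p.1, p.2)) '' S)

/-- The convex conic hull of `S ∪ {0}`: all finite nonnegative combinations of elements of `S`. -/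
def coneHull {E : Type*} [AddCommMonoid E] [Module ℝ E] (S : Set E) : Set E :=
  {x | ∃ (n : ℕ) (c : Fin n → ℝ) (v : Fin n → E),
    (∀ i, 0 ≤ c i) ∧ (∀ i, v i ∈ S) ∧ x = ∑ i, c i • v i}

/-- The set of ε-normals to `Ω` at `x`. -/
def epsNormal (Ω : Set X) (x : X) (ε : ℝ) : Set (X →L[ℝ] ℝ) :=
  {p | ∀ γ > (0:ℝ), ∃ δ > (0:ℝ), ∀ u ∈ Ω, ‖u - x‖ < δ → p (u - x) ≤ (ε + γ) * ‖u - x‖}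

/-- The Fréchet (regular) normal cone to `Ω` at `x`. -/
def frechetNormal (Ω : Set X) (x : X) : Set (X →L[ℝ] ℝ) := epsNormal Ω x 0

/-- The limiting (Mordukhovich) normal cone to `Ω` at `xb`. -/
def limitingNormal (Ω : Set X) (xb : X) : Set (X →L[ℝ] ℝ) :=
  {p | ∃ (ε : ℕ → ℝ) (xs : ℕ → X) (ps : ℕ → X →L[ℝ] ℝ),
    (∀ n, 0 ≤ ε n) ∧ Tendsto ε atTop (𝓝 0) ∧
    (∀ n, xs n ∈ Ω) ∧ Tendsto xs atTop (𝓝 xb) ∧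
    (∀ n, ps n ∈ epsNormal Ω (xs n) (ε n)) ∧
    (∀ v : X, Tendsto (fun n => ps n v) atTop (𝓝 (p v)))}

/-- The normal cone of convex analysis to `Ω` at `xb`. -/
def convexNormal (Ω : Set X) (xb : X) : Set (X →L[ℝ] ℝ) :=
  {p | ∀ x ∈ Ω, p (x - xb) ≤ 0}

/-- The subdifferential of convex analysis of `f` at `xb`. -/
def convexSubdiff (f : X → ℝ) (xb : X) : Set (X →L[ℝ] ℝ) :=
  {p | ∀ x, f xb + p (x - xb) ≤ f x}

variable {Y : Type*} [NormedAddCommGroup Y] [NormedSpace ℝ Y]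

/-- The image `A*(Y*)` of the adjoint operator `A* : Y* → X*`. -/
def adjRange (A : X →L[ℝ] Y) : Set (X →L[ℝ] ℝ) :=
  Set.range fun q : Y →L[ℝ] ℝ => q.comp A

variable {T : Type*}

/-- Uniform Fréchet differentiability of the family `g = (g t)` at `xb`:
`s(η) := sup_t sup_{x ∈ B_η(xb), x ≠ xb} |g t x - g t xb - ⟨dg t, x - xb⟩|/‖x - xb‖ → 0` as `η ↓ 0`. -/
def UnifFrechetDiffAt (g : T → X → ℝ) (dg : T → X →L[ℝ] ℝ) (xb : X) : Prop :=
  ∀ ε > (0:ℝ), ∃ η > (0:ℝ), ∀ t : T, ∀ x : X, ‖x - xb‖ ≤ η →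
    |g t x - g t xb - dg t (x - xb)| ≤ ε * ‖x - xb‖

/-- Uniform strict differentiability of the family `g = (g t)` at `xb`:
`r(η) := sup_t sup_{x,x' ∈ B_η(xb), x ≠ x'} |g t x - g t x' - ⟨dg t, x - x'⟩|/‖x - x'‖ → 0`
as `η ↓ 0`. -/
def UnifStrictDiffAt (g : T → X → ℝ) (dg : T → X →L[ℝ] ℝ) (xb : X) : Prop :=
  ∀ ε > (0:ℝ), ∃ η > (0:ℝ), ∀ t : T, ∀ x x' : X, ‖x - xb‖ ≤ η → ‖x' - xb‖ ≤ η →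
    |g t x - g t x' - dg t (x - x')| ≤ ε * ‖x - x'‖

/-- The inequality part of the PMFCQ at `xb` with the direction `xt`:
`inf_{ε>0} sup_{t ∈ T_ε(xb)} ⟨dg t, xt⟩ < 0`, where `T_ε(xb) = {t | g t xb ≥ -ε}`. -/
def PMFCQat (g : T → X → ℝ) (dg : T → X →L[ℝ] ℝ) (xb xt : X) : Prop :=
  ∃ ε > (0:ℝ), ∃ δ > (0:ℝ), ∀ t : T, -ε ≤ g t xb → dg t xt ≤ -δ

end Defs

theorem wd_rep {X : Type*} [NormedAddCommGroup X] [NormedSpace ℝ X] (f : (WeakDual ℝ X × ℝ) →L[ℝ] ℝ) :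
    ∃ (d : X) (s : ℝ), ∀ z r, f (z, r) = z d + s * r := by
  obtain ⟨d, hd⟩ := LinearMap.dualEmbedding_surjective (topDualPairing ℝ X) (f.comp (ContinuousLinearMap.inl ℝ (WeakDual ℝ X) ℝ))
  refine ⟨d, f (0,1), fun z r => ?_⟩
  have h1 : f (z, 0) = z d := by
    have := DFunLike.congr_fun hd z
    exact this.symm
  have : ((z, r) : WeakDual ℝ X × ℝ) = (z, 0) + r • (0, 1) := by simp
  rw [this, map_add, map_smul, h1, smul_eq_mul, mul_comm]

theorem adj_mem {X Y : Type*} [NormedAddCommGroup X] [NormedSpace ℝ X] [CompleteSpace X]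
    [NormedAddCommGroup Y] [NormedSpace ℝ Y] [CompleteSpace Y] (A : X →L[ℝ] Y)
    (hA : Function.Surjective A) (p : X →L[ℝ] ℝ) (hp : ∀ x, A x = 0 → p x = 0) :
    ∃ q : Y →L[ℝ] ℝ, q.comp A = p := by
  obtain ⟨C, hC, hC'⟩ := A.exists_preimage_norm_le hA
  choose r hr hn using hC'
  have key : ∀ x, p (r (A x)) = p x := fun x => by
    have := hp (r (A x) - x) (by simp [hr])
    rw [map_sub] at this; linarith
  have key2 : ∀ x y, A x = y → p (r y) = p x := by rintro x _ rfl; exact key x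
  let q : Y →ₗ[ℝ] ℝ := 
    { toFun := fun y => p (r y)
      map_add' := fun y z => by
        rw [key2 (r y + r z) (y + z) (by simp [hr]), map_add]
      map_smul' := fun c y => by
        rw [key2 (c • r y) (c • y) (by simp [hr]), map_smul]; rfl }
  refine ⟨q.mkContinuous (‖p‖ * C) fun y => ?_, ?_⟩
  · calc ‖p (r y)‖ ≤ ‖p‖ * ‖r y‖ := p.le_opNorm _
      _ ≤ ‖p‖ * (C * ‖y‖) := by gcongr; exact hn y
      _ = _ := by ring
  · ext x; exact key x

theorem lyus {X Y : Type*} [NormedAddCommGroup X] [NormedSpace ℝ X] [CompleteSpace X]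
    [NormedAddCommGroup Y] [NormedSpace ℝ Y] [CompleteSpace Y]
    (h : X → Y) (dh : X →L[ℝ] Y) (xb : X) (hhd : HasStrictFDerivAt h dh xb) (h0 : h xb = 0)
    (hsurj : Function.Surjective dh) (e : X) (he : dh e = 0) (κ : ℝ) (hκ : 0 < κ) :
    ∀ᶠ s in 𝓝[>] (0:ℝ), ∃ u, ‖u - (xb + s • e)‖ ≤ κ * s ∧ h u = 0 := by
  have hr : dh.range = ⊤ := LinearMap.range_eq_top.2 hsurj
  set R := dh.nonlinearRightInverseOfSurjective hr
  have hR : 0 < R.nnnorm := dh.nonlinearRightInverseOfSurjective_nnnorm_pos hr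
  set c : NNReal := R.nnnorm⁻¹ / 2
  have hc : 0 < c := by positivity
  obtain ⟨U, hU, hap⟩ := hhd.approximates_deriv_on_nhds (c := c) (Or.inr hc)
  obtain ⟨ρ, hρ, hball⟩ := Metric.mem_nhds_iff.1 hU
  have hfd := hhd.hasFDerivAt.isLittleO
  have hlin : Tendsto (fun s : ℝ => xb + s • e) (𝓝[>] 0) (𝓝 xb) := by
    have : Continuous (fun s : ℝ => xb + s • e) := by fun_prop
    have h2 := this.tendsto 0
    simp only [zero_smul, add_zero] at h2
    exact h2.mono_left nhdsWithin_le_nhds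
  have hε : 0 < c * κ / (‖e‖ + 1) := by positivity
  have h1 := hlin.eventually (hfd.def hε)
  have h2 : ∀ᶠ s in 𝓝[>] (0:ℝ), s * (‖e‖ + κ) < ρ := by
    have : Continuous (fun s : ℝ => s * (‖e‖ + κ)) := by fun_prop
    have h2 := this.tendsto 0
    simp only [zero_mul] at h2
    exact (h2.mono_left nhdsWithin_le_nhds).eventually (gt_mem_nhds hρ)
  filter_upwards [h1, h2, self_mem_nhdsWithin] with s hs1 hs2 (hs : 0 < s)
  simp only [h0, add_sub_cancel_left, map_smul, he, smul_zero, sub_zero, norm_smul, Real.norm_eq_abs, abs_of_pos hs] at hs1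
  have hsub : Metric.closedBall (xb + s • e) (κ * s) ⊆ U := by
    intro x hx
    apply hball
    rw [Metric.mem_closedBall, dist_eq_norm] at hx
    rw [Metric.mem_ball, dist_eq_norm]
    calc ‖x - xb‖ = ‖(x - (xb + s • e)) + s • e‖ := by congr 1; abel
      _ ≤ κ * s + s * ‖e‖ := by
        refine (norm_add_le _ _).trans (add_le_add hx ?_)
        rw [norm_smul, Real.norm_eq_abs, abs_of_pos hs]
      _ < ρ := by linarith
  have hS := hap.surjOn_closedBall_of_nonlinearRightInverse R (by positivity) hsub
  obtain ⟨u, hu, hu0⟩ := hS (show (0:Y) ∈ _ by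
    rw [Metric.mem_closedBall, dist_eq_norm, zero_sub, norm_neg]
    have : (((R.nnnorm : ℝ))⁻¹ - (c:ℝ)) = c := by simp only [c]; push_cast; ring
    rw [this]
    refine hs1.trans ?_
    rw [div_mul_eq_mul_div, div_le_iff₀ (by positivity)]
    have : 0 ≤ (c:ℝ) * κ * s := by positivity
    nlinarith)
  refine ⟨u, ?_, hu0⟩
  rwa [Metric.mem_closedBall, dist_eq_norm] at hu

theorem closed_sum {E : Type*} [AddCommGroup E] [TopologicalSpace E] [IsTopologicalAddGroup E]
    (K L : Set E) (φ : E → ℝ) (hφ : Continuous φ) (hadd : ∀ x y, φ (x + y) = φ x + φ y)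
    (hL0 : ∀ l ∈ L, φ l = 0) (hL : IsClosed L)
    (hC : ∀ R : ℝ, IsCompact (K ∩ {k | -R ≤ φ k})) : IsClosed (K + L) := by
  refine isClosed_of_closure_subset fun z hz => ?_
  have hS : IsClosed ((K ∩ {k | -(1 - φ z) ≤ φ k}) + L) := hL.add_left_of_isCompact (hC _)
  have hzS : z ∈ closure ((K ∩ {k | -(1 - φ z) ≤ φ k}) + L) := by
    rw [mem_closure_iff_nhds] at hz ⊢
    intro t ht
    have h1 : φ ⁻¹' (Ioi (φ z - 1)) ∈ 𝓝 z :=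
      hφ.continuousAt.preimage_mem_nhds (Ioi_mem_nhds (by linarith))
    obtain ⟨w, ⟨hwt, hw⟩, k, hk, l, hl, rfl⟩ := hz _ (inter_mem ht h1)
    refine ⟨k + l, hwt, k, ⟨hk, ?_⟩, l, hl, rfl⟩
    simp only [mem_preimage, mem_Ioi, hadd, hL0 l hl] at hw
    simp only [mem_ofPred_eq]; linarith
  rw [hS.closure_eq] at hzS
  exact add_subset_add_right inter_subset_left hzS

theorem coneHull_add {E : Type*} [AddCommMonoid E] [Module ℝ E] {S : Set E} {x y : E}
    (hx : x ∈ coneHull S) (hy : y ∈ coneHull S) : x + y ∈ coneHull S := by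
  obtain ⟨n, c, v, hc, hv, rfl⟩ := hx
  obtain ⟨m, c', v', hc', hv', rfl⟩ := hy
  refine ⟨n + m, Fin.append c c', Fin.append v v', ?_, ?_, ?_⟩
  · intro i; refine Fin.addCases (fun i => ?_) (fun i => ?_) i <;> simp [hc, hc']
  · intro i; refine Fin.addCases (fun i => ?_) (fun i => ?_) i <;> simp [hv, hv']
  · simp [Fin.sum_univ_add]

theorem coneHull_zero {E : Type*} [AddCommMonoid E] [Module ℝ E] (S : Set E) :
    (0 : E) ∈ coneHull S := ⟨0, fun _ => 0, fun _ => 0, by simp, by simp, by simp⟩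

theorem coneHull_smul {E : Type*} [AddCommMonoid E] [Module ℝ E] {S : Set E} {x : E} {a : ℝ}
    (ha : 0 ≤ a) (hx : x ∈ coneHull S) : a • x ∈ coneHull S := by
  obtain ⟨n, c, v, hc, hv, rfl⟩ := hx
  exact ⟨n, fun i => a * c i, v, fun i => mul_nonneg ha (hc i), hv, by
    simp [Finset.smul_sum, mul_smul]⟩

theorem coneHull_self {E : Type*} [AddCommMonoid E] [Module ℝ E] {S : Set E} {x : E}
    (hx : x ∈ S) : x ∈ coneHull S :=
  ⟨1, fun _ => 1, fun _ => x, by simp, by simpa using hx, by simp⟩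

theorem coneHull_subset {E : Type*} [AddCommMonoid E] [Module ℝ E] {S C : Set E} (h0 : 0 ∈ C)
    (hadd : ∀ x y, x ∈ C → y ∈ C → x + y ∈ C) (hsmul : ∀ (a : ℝ) x, 0 ≤ a → x ∈ C → a • x ∈ C)
    (hS : S ⊆ C) : coneHull S ⊆ C := by
  rintro x ⟨n, c, v, hc, hv, rfl⟩
  exact Finset.sum_induction _ (· ∈ C) (fun a b => hadd a b) h0
    (fun i _ => hsmul _ _ (hc i) (hS (hv i)))

/-- Separation of a point from a closed convex cone. -/
theorem cone_sep {E : Type*} [AddCommGroup E] [Module ℝ E] [TopologicalSpace E]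
    [IsTopologicalAddGroup E] [ContinuousSMul ℝ E] [LocallyConvexSpace ℝ E] (C : Set E)
    (h0 : 0 ∈ C) (hadd : ∀ x y, x ∈ C → y ∈ C → x + y ∈ C)
    (hsmul : ∀ (a : ℝ) x, 0 ≤ a → x ∈ C → a • x ∈ C) (hC : IsClosed C) (z : E) (hz : z ∉ C) :
    ∃ f : E →L[ℝ] ℝ, f z < 0 ∧ ∀ x ∈ C, 0 ≤ f x := by
  have hconv : Convex ℝ C := fun x hx y hy a b ha hb _ =>
    hadd _ _ (hsmul a x ha hx) (hsmul b y hb hy)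
  obtain ⟨f, u, hu, hf⟩ := geometric_hahn_banach_point_closed hconv hC hz
  have hu0 : u < 0 := by simpa using hf 0 h0
  refine ⟨f, hu.trans hu0, fun x hx => ?_⟩
  by_contra! hneg
  have := hf ((u / f x) • x) (hsmul _ _ (div_nonneg_of_nonpos hu0.le hneg.le) hx)
  rw [map_smul, smul_eq_mul, div_mul_cancel₀ _ hneg.ne] at this
  exact lt_irrefl _ this

theorem fn_zero {X : Type*} [NormedAddCommGroup X] [NormedSpace ℝ X] (Ω : Set X) (x : X) :
    (0 : X →L[ℝ] ℝ) ∈ frechetNormal Ω x := by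
  intro γ hγ
  refine ⟨1, one_pos, fun u _ _ => ?_⟩
  simp only [_root_.zero_apply]; positivity

theorem fn_add {X : Type*} [NormedAddCommGroup X] [NormedSpace ℝ X] (Ω : Set X) (x : X)
    (p q : X →L[ℝ] ℝ) (hp : p ∈ frechetNormal Ω x) (hq : q ∈ frechetNormal Ω x) :
    p + q ∈ frechetNormal Ω x := by
  intro γ hγ
  obtain ⟨δ₁, h1, h1'⟩ := hp (γ / 2) (by positivity)
  obtain ⟨δ₂, h2, h2'⟩ := hq (γ / 2) (by positivity)
  refine ⟨min δ₁ δ₂, lt_min h1 h2, fun u hu hd => ?_⟩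
  have a := h1' u hu (hd.trans_le (min_le_left _ _))
  have b := h2' u hu (hd.trans_le (min_le_right _ _))
  rw [_root_.add_apply]; linarith

theorem fn_smul {X : Type*} [NormedAddCommGroup X] [NormedSpace ℝ X] (Ω : Set X) (x : X)
    (a : ℝ) (p : X →L[ℝ] ℝ) (ha : 0 ≤ a) (hp : p ∈ frechetNormal Ω x) :
    a • p ∈ frechetNormal Ω x := by
  intro γ hγ
  obtain ⟨δ₁, h1, h1'⟩ := hp (γ / (a + 1)) (by positivity)
  refine ⟨δ₁, h1, fun u hu hd => ?_⟩
  have b := h1' u hu hd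
  rw [_root_.smul_apply, smul_eq_mul]
  calc a * p (u - x) ≤ a * ((0 + γ / (a + 1)) * ‖u - x‖) := by gcongr
    _ = (a / (a + 1)) * (γ * ‖u - x‖) := by field_simp; ring
    _ ≤ 1 * (γ * ‖u - x‖) := by
      gcongr
      rw [div_le_one (by positivity)]; linarith
    _ = _ := by ring

/-- A functional agreeing on `Ω` with a first-order small quantity up to sign. -/
theorem fn_of_littleO {X : Type*} [NormedAddCommGroup X] [NormedSpace ℝ X] (Ω : Set X) (x : X)
    (f : X → ℝ) (p : X →L[ℝ] ℝ) (hf : HasFDerivAt f p x) (hΩ : ∀ u ∈ Ω, f u ≤ f x) :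
    p ∈ frechetNormal Ω x := by
  intro γ hγ
  obtain ⟨δ, hδ, h⟩ := Metric.eventually_nhds_iff.1 (hf.isLittleO.def hγ)
  refine ⟨δ, hδ, fun u hu hd => ?_⟩
  have h1 := h (y := u) (by rwa [dist_eq_norm])
  rw [Real.norm_eq_abs] at h1
  have := neg_le_of_abs_le h1
  have := hΩ u hu
  linarith

/-- Every Fréchet normal is nonpositive on linearized feasible directions. -/
theorem lin_dir {X Y T : Type*} [NormedAddCommGroup X] [NormedSpace ℝ X] [CompleteSpace X]
    [NormedAddCommGroup Y] [NormedSpace ℝ Y] [CompleteSpace Y]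
    (g : T → X → ℝ) (dg : T → X →L[ℝ] ℝ) (h : X → Y) (dh : X →L[ℝ] Y) (xb : X)
    (hhd : HasStrictFDerivAt h dh xb)
    (M : ℝ) (hM0 : 0 ≤ M) (hM : ∀ t : T, ‖dg t‖ ≤ M)
    (hxb : xb ∈ {x : X | h x = 0 ∧ ∀ t : T, g t x ≤ 0})
    (hunif : UnifFrechetDiffAt g dg xb)
    (hsurj : Function.Surjective dh)
    (xt : X) (hxt : dh xt = 0) (hpm : PMFCQat g dg xb xt)
    (p : X →L[ℝ] ℝ) (hp : p ∈ frechetNormal {x : X | h x = 0 ∧ ∀ t : T, g t x ≤ 0} xb)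
    (d : X) (hd : dh d = 0) (hdg : ∀ t, g t xb + dg t d ≤ 0) : p d ≤ 0 := by
  obtain ⟨ε, hε, δ, hδ, hpm⟩ := hpm
  have main : ∀ l : ℝ, 0 < l → p d + l * p xt ≤ 0 := by
    intro l hl
    set e := d + l • xt with he
    have hpe : p e = p d + l * p xt := by simp [he]
    have hdhe : dh e = 0 := by simp [he, hd, hxt]
    rw [← hpe]
    have ev1 : ∀ᶠ κ in 𝓝[>] (0:ℝ), κ * (M + ‖e‖ + 1) < l * δ := by
      have : Continuous (fun s : ℝ => s * (M + ‖e‖ + 1)) := by fun_prop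
      have h2 := this.tendsto 0
      simp only [zero_mul] at h2
      exact (h2.mono_left nhdsWithin_le_nhds).eventually (gt_mem_nhds (by positivity))
    have ev2 : ∀ᶠ κ in 𝓝[>] (0:ℝ), κ < 1 :=
      mem_nhdsWithin_of_mem_nhds (gt_mem_nhds one_pos)
    have lim : Tendsto (fun κ : ℝ => κ * (‖e‖ + 1 + ‖p‖)) (𝓝[>] 0) (𝓝 0) := by
      have : Continuous (fun κ : ℝ => κ * (‖e‖ + 1 + ‖p‖)) := by fun_prop
      have h2 := this.tendsto 0
      simp only [zero_mul] at h2
      exact h2.mono_left nhdsWithin_le_nhds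
    refine ge_of_tendsto lim ?_
    filter_upwards [ev1, ev2, self_mem_nhdsWithin] with κ hκ1 hκ2 (hκ : 0 < κ)
    obtain ⟨η, hη, hgu⟩ := hunif κ hκ
    obtain ⟨ρ, hρ, hpu⟩ := hp κ hκ
    have small : ∀ B c : ℝ, 0 < c → ∀ᶠ s in 𝓝[>] (0:ℝ), s * B < c := by
      intro B c hc
      have : Continuous (fun s : ℝ => s * B) := by fun_prop
      have h2 := this.tendsto 0
      simp only [zero_mul] at h2
      exact (h2.mono_left nhdsWithin_le_nhds).eventually (gt_mem_nhds hc)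
    have ex := ((lyus h dh xb hhd hxb.1 hsurj e hdhe κ hκ).and ((small (‖e‖ + 1) η hη).and
      ((small (‖e‖ + 1) ρ hρ).and ((small ((M + 1) * (‖e‖ + 1)) ε hε).and
      ((small 1 1 one_pos).and self_mem_nhdsWithin))))).exists
    obtain ⟨s, ⟨u, hu, hu0⟩, s1, s2, s3, s4, (hs : 0 < s)⟩ := ex
    set r := u - (xb + s • e) with hr
    have hur : u - xb = s • e + r := by rw [hr]; abel
    have hun : ‖u - xb‖ ≤ s * (‖e‖ + 1) := by
      rw [hur]
      refine (norm_add_le _ _).trans ?_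
      rw [norm_smul, Real.norm_eq_abs, abs_of_pos hs]
      nlinarith
    have hg : ∀ t, g t u ≤ 0 := by
      intro t
      have h1 := (abs_le.1 (hgu t u (hun.trans s1.le))).2
      have h2 : κ * ‖u - xb‖ ≤ κ * (s * (‖e‖ + 1)) := by gcongr
      by_cases ht : -ε ≤ g t xb
      · have h3 : dg t r ≤ M * (κ * s) := by
          refine (le_abs_self _).trans (((dg t).le_opNorm r).trans ?_)
          exact mul_le_mul (hM t) hu (norm_nonneg _) hM0
        have h4 : dg t (u - xb) = s * dg t d + s * l * dg t xt + dg t r := by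
          rw [hur, he]; simp; ring
        have h5 := hpm t ht
        have h6 := hdg t
        have h7 := hxb.2 t
        have h8 : s * dg t d ≤ s * (- g t xb) := by gcongr; linarith
        have h9 : s * l * dg t xt ≤ s * l * (-δ) := by gcongr
        have h10 : s * (κ * (M + ‖e‖ + 1)) ≤ s * (l * δ) := by gcongr
        have h11 : (1 - s) * g t xb ≤ 0 := mul_nonpos_of_nonneg_of_nonpos (by linarith) h7
        nlinarith
      · have h3 : dg t (u - xb) ≤ M * (s * (‖e‖ + 1)) := by
          refine (le_abs_self _).trans (((dg t).le_opNorm _).trans ?_)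
          exact mul_le_mul (hM t) hun (norm_nonneg _) hM0
        have h4 : κ * (s * (‖e‖ + 1)) ≤ 1 * (s * (‖e‖ + 1)) := by gcongr
        push Not at ht
        nlinarith
    have h1 := hpu u ⟨hu0, hg⟩ (hun.trans_lt s2)
    have h2 : -(‖p‖ * (κ * s)) ≤ p r := by
      have : |p r| ≤ ‖p‖ * (κ * s) := (p.le_opNorm r).trans (by gcongr)
      exact neg_le_of_abs_le this
    have h3 : p (u - xb) = s * p e + p r := by rw [hur]; simp
    have h4 : κ * ‖u - xb‖ ≤ κ * (s * (‖e‖ + 1)) := by gcongr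
    have h5 : s * p e ≤ s * (κ * (‖e‖ + 1 + ‖p‖)) := by nlinarith
    exact le_of_mul_le_mul_left h5 hs
  have lim : Tendsto (fun l : ℝ => p d + l * p xt) (𝓝[>] 0) (𝓝 (p d)) := by
    have : Continuous (fun l : ℝ => p d + l * p xt) := by fun_prop
    have h2 := this.tendsto 0
    simp only [zero_mul, add_zero] at h2
    exact h2.mono_left nhdsWithin_le_nhds
  refine le_of_tendsto lim ?_
  filter_upwards [self_mem_nhdsWithin] with l hl using main l hl

/-- under the standing assumptions, if `{g t}` is uniformly Fréchet
differentiable at `xb ∈ Ω` and both the PMFCQ and the NFMCQ hold at `xb`, then the Fréchet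
normal cone to `Ω` at `xb` is computed without closure:
`N̂(xb; Ω) = cone{dg t : t ∈ T(xb)} + ∇h(xb)*(Y*)`. -/
theorem statement12 {X Y T : Type*} [NormedAddCommGroup X] [NormedSpace ℝ X] [CompleteSpace X]
    [NormedAddCommGroup Y] [NormedSpace ℝ Y] [CompleteSpace Y]
    (g : T → X → ℝ) (dg : T → X →L[ℝ] ℝ) (h : X → Y) (dh : X →L[ℝ] Y) (xb : X)
    (hgd : ∀ t : T, HasFDerivAt (g t) (dg t) xb)
    (hhd : HasStrictFDerivAt h dh xb)
    (hbd : ∃ M : ℝ, ∀ t : T, ‖dg t‖ ≤ M)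
    (hxb : xb ∈ {x : X | h x = 0 ∧ ∀ t : T, g t x ≤ 0})
    (hunif : UnifFrechetDiffAt g dg xb)
    (hsurj : Function.Surjective dh)
    (hpmfcq : ∃ xt : X, dh xt = 0 ∧ PMFCQat g dg xb xt)
    (hnfmcq : IsWeakStarClosedProd (coneHull (Set.range fun t : T => (dg t, dg t xb - g t xb)))) :
    frechetNormal {x : X | h x = 0 ∧ ∀ t : T, g t x ≤ 0} xb =
      coneHull (dg '' {t : T | g t xb = 0}) + adjRange dh := by
  obtain ⟨M₀, hM₀⟩ := hbd
  set M := max M₀ 0 with hMdef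
  have hM0 : 0 ≤ M := le_max_right _ _
  have hM : ∀ t, ‖dg t‖ ≤ M := fun t => (hM₀ t).trans (le_max_left _ _)
  obtain ⟨xt, hxt, hpm⟩ := hpmfcq
  apply Subset.antisymm
  · intro p hp
    have hlin := lin_dir g dg h dh xb hhd M hM0 hM hxb hunif hsurj xt hxt hpm p hp
    have hb : ∀ t, g t xb ≤ 0 := hxb.2
    obtain ⟨ε, hε, δ, hδ, hpm⟩ := hpm
    -- the two pieces of the closed cone
    let J : (X →L[ℝ] ℝ) × ℝ → WeakDual ℝ X × ℝ := fun p => (toWD p.1, p.2)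
    have Jadd : ∀ a b, J (a + b) = J a + J b := fun _ _ => rfl
    have Jsmul : ∀ (c : ℝ) a, J (c • a) = c • J a := fun _ _ => rfl
    set S : Set ((X →L[ℝ] ℝ) × ℝ) := Set.range fun t : T => (dg t, dg t xb - g t xb) with hS
    let K : Set (WeakDual ℝ X × ℝ) := J '' coneHull S
    have hK : IsClosed K := hnfmcq
    let L : Set (WeakDual ℝ X × ℝ) := {z | (∀ x, dh x = 0 → z.1 x = 0) ∧ z.2 = z.1 xb}
    have evc : ∀ x : X, Continuous fun z : WeakDual ℝ X × ℝ => z.1 x := fun x =>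
      (WeakDual.eval_continuous x).comp continuous_fst
    have hL : IsClosed L := by
      have : L = (⋂ x, ⋂ (_ : dh x = 0), {z : WeakDual ℝ X × ℝ | z.1 x = 0}) ∩
          {z | z.2 = z.1 xb} := by
        ext z; simp [L]
      rw [this]
      refine IsClosed.inter (isClosed_iInter fun x => isClosed_iInter fun _ => ?_) ?_
      · exact isClosed_eq (evc x) continuous_const
      · exact isClosed_eq continuous_snd (evc xb)
    set μ : ℝ := 1 + (M * ‖xt‖ + δ) / ε with hμ
    let φ : WeakDual ℝ X × ℝ → ℝ := fun z => z.1 xt + μ * z.1 xb - μ * z.2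
    have hφc : Continuous φ :=
      ((evc xt).add ((evc xb).const_mul μ)).sub (continuous_snd.const_mul μ)
    have hφadd : ∀ x y, φ (x + y) = φ x + φ y := by
      intro x y
      have e1 : ∀ v, (x + y).1 v = x.1 v + y.1 v := fun _ => rfl
      simp only [φ, e1, Prod.snd_add]; ring
    have hφsmul : ∀ (c : ℝ) x, φ (c • x) = c * φ x := by
      intro c x
      have e1 : ∀ v, (c • x).1 v = c * x.1 v := fun _ => rfl
      simp only [φ, e1, Prod.smul_snd, smul_eq_mul]; ring
    have hφL : ∀ l ∈ L, φ l = 0 := by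
      rintro l ⟨h1, h2⟩
      simp only [φ, h2, h1 xt hxt]; ring
    have hφg : ∀ t, φ (J (dg t, dg t xb - g t xb)) ≤ -(δ + -g t xb) := by
      intro t
      have e1 : φ (J (dg t, dg t xb - g t xb)) = dg t xt + μ * g t xb := by
        change dg t xt + μ * dg t xb - μ * (dg t xb - g t xb) = _
        ring
      rw [e1]
      have hμ1 : 0 ≤ (M * ‖xt‖ + δ) / ε := by positivity
      by_cases ht : -ε ≤ g t xb
      · have := hpm t ht
        have h2 : (M * ‖xt‖ + δ) / ε * g t xb ≤ 0 :=
          mul_nonpos_of_nonneg_of_nonpos hμ1 (hb t)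
        rw [hμ]; linarith
      · push Not at ht
        have h1 : dg t xt ≤ M * ‖xt‖ := (le_abs_self _).trans
          (((dg t).le_opNorm xt).trans (by gcongr; exact hM t))
        have h2 : (M * ‖xt‖ + δ) / ε * g t xb ≤ (M * ‖xt‖ + δ) / ε * (-ε) := by gcongr
        have h3 : (M * ‖xt‖ + δ) / ε * (-ε) = -(M * ‖xt‖ + δ) := by field_simp
        rw [hμ]; linarith
    set N : ℝ := M * ‖xb‖ / δ + 1 with hN
    have hN0 : 0 ≤ N := by positivity
    have hbound : coneHull S ⊆
        {k | δ * ‖k.1‖ ≤ M * (-φ (J k)) ∧ |k.2| ≤ N * (-φ (J k))} := by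
      refine coneHull_subset ?_ ?_ ?_ ?_
      · have : φ (J 0) = 0 := by
          have := hφsmul 0 (J 0)
          rw [← Jsmul, zero_smul, zero_mul] at this; exact this
        simp [this]
      · rintro x y ⟨h1, h2⟩ ⟨h3, h4⟩
        refine ⟨?_, ?_⟩
        · have := norm_add_le x.1 y.1
          rw [Jadd, hφadd, Prod.fst_add]
          nlinarith
        · have := abs_add_le x.2 y.2
          rw [Jadd, hφadd, Prod.snd_add]
          nlinarith
      · rintro a x ha ⟨h1, h2⟩
        refine ⟨?_, ?_⟩
        · rw [Jsmul, hφsmul, Prod.smul_fst, norm_smul, Real.norm_eq_abs, abs_of_nonneg ha]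
          nlinarith [mul_le_mul_of_nonneg_left h1 ha]
        · rw [Jsmul, hφsmul, Prod.smul_snd, smul_eq_mul, abs_mul, abs_of_nonneg ha]
          nlinarith [mul_le_mul_of_nonneg_left h2 ha]
      · rintro _ ⟨t, rfl⟩
        have h1 := hφg t
        have h2 := hb t
        have h3 := hM t
        refine ⟨?_, ?_⟩
        · calc δ * ‖dg t‖ ≤ δ * M := by gcongr
            _ = M * δ := mul_comm _ _
            _ ≤ _ := by
              refine mul_le_mul_of_nonneg_left ?_ hM0
              linarith
        · have h4 : |dg t xb| ≤ M * ‖xb‖ := ((dg t).le_opNorm xb).trans (by gcongr)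
          have h5 : |dg t xb - g t xb| ≤ M * ‖xb‖ + -g t xb := by
            have := abs_le.1 h4
            rw [abs_le]; constructor <;> linarith
          have h6 : N * (δ + -g t xb) ≤ N * (-φ (J (dg t, dg t xb - g t xb))) :=
            mul_le_mul_of_nonneg_left (by linarith) hN0
          refine h5.trans (le_trans ?_ h6)
          have h7 : N * (δ + -g t xb) =
              M * ‖xb‖ + δ + -g t xb + M * ‖xb‖ / δ * (-g t xb) := by
            rw [hN]; field_simp; ring
          have h8 : 0 ≤ M * ‖xb‖ / δ * (-g t xb) :=
            mul_nonneg (by positivity) (by linarith)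
          linarith
    have hC : ∀ R : ℝ, IsCompact (K ∩ {k | -R ≤ φ k}) := by
      intro R
      have hcomp : IsCompact ((WeakDual.toStrongDual ⁻¹'
          Metric.closedBall (0 : StrongDual ℝ X) (M * R / δ)) ×ˢ Icc (-(N * R)) (N * R)) :=
        (WeakDual.isCompact_closedBall (𝕜 := ℝ) (E := X) 0 (M * R / δ)).prod isCompact_Icc
      refine hcomp.of_isClosed_subset (hK.inter (isClosed_le continuous_const hφc)) ?_
      rintro _ ⟨⟨k, hk, rfl⟩, hR⟩
      obtain ⟨h1, h2⟩ := hbound hk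
      have hR' : -φ (J k) ≤ R := by
        have : -R ≤ φ (J k) := hR
        linarith
      refine ⟨?_, ?_⟩
      · change k.1 ∈ Metric.closedBall (0 : StrongDual ℝ X) (M * R / δ)
        rw [mem_closedBall_zero_iff, le_div_iff₀ hδ]
        have := mul_le_mul_of_nonneg_left hR' hM0
        linarith
      · change k.2 ∈ Icc (-(N * R)) (N * R)
        have := mul_le_mul_of_nonneg_left hR' hN0
        rw [mem_Icc, ← abs_le]; linarith
    have hKL : IsClosed (K + L) := closed_sum K L φ hφc hφadd hφL hL hC
    have hK0 : (0 : WeakDual ℝ X × ℝ) ∈ K := ⟨0, coneHull_zero _, rfl⟩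
    have hL0 : (0 : WeakDual ℝ X × ℝ) ∈ L := ⟨fun _ _ => rfl, rfl⟩
    have hLsmul : ∀ (a : ℝ) x, x ∈ L → a • x ∈ L := by
      rintro a x ⟨h1, h2⟩
      refine ⟨fun v hv => ?_, ?_⟩
      · change a * x.1 v = 0
        rw [h1 v hv, mul_zero]
      · change a * x.2 = a * x.1 xb
        rw [h2]
    have hLadd : ∀ x y, x ∈ L → y ∈ L → x + y ∈ L := by
      rintro x y ⟨h1, h2⟩ ⟨h3, h4⟩
      refine ⟨fun v hv => ?_, ?_⟩
      · change x.1 v + y.1 v = 0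
        rw [h1 v hv, h3 v hv, add_zero]
      · change x.2 + y.2 = x.1 xb + y.1 xb
        rw [h2, h4]
    have hmem : J (p, p xb) ∈ K + L := by
      by_contra hnot
      have : LocallyConvexSpace ℝ (WeakDual ℝ X) :=
        inferInstanceAs (LocallyConvexSpace ℝ (WeakBilin (topDualPairing ℝ X)))
      obtain ⟨f, hf1, hf2⟩ := cone_sep (K + L) ⟨0, hK0, 0, hL0, by simp⟩
        (by
          rintro _ _ ⟨_, ⟨k, hk, rfl⟩, l, hl, rfl⟩ ⟨_, ⟨k', hk', rfl⟩, l', hl', rfl⟩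
          refine ⟨J (k + k'), ⟨_, coneHull_add hk hk', rfl⟩, l + l', hLadd _ _ hl hl', ?_⟩
          simp only [Jadd]; abel)
        (by
          rintro a _ ha ⟨_, ⟨k, hk, rfl⟩, l, hl, rfl⟩
          refine ⟨J (a • k), ⟨_, coneHull_smul ha hk, rfl⟩, a • l, hLsmul _ _ hl, ?_⟩
          simp only [Jsmul, smul_add])
        hKL _ hnot
      obtain ⟨d, s, hds⟩ := wd_rep f
      have hfL : ∀ l ∈ L, 0 ≤ f l := fun l hl => hf2 l ⟨0, hK0, l, hl, by simp⟩
      have hfK : ∀ t, 0 ≤ dg t d + s * (dg t xb - g t xb) := by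
        intro t
        have := hf2 (J (dg t, dg t xb - g t xb))
          ⟨_, ⟨_, coneHull_self ⟨t, rfl⟩, rfl⟩, 0, hL0, by simp⟩
        exact this.trans_eq (hds _ _)
      have hfp : p d + s * p xb < 0 := (hds (toWD p) (p xb)).symm.trans_lt hf1
      have hq : ∀ q : Y →L[ℝ] ℝ, 0 ≤ q (dh (d + s • xb)) := by
        intro q
        have hmemL : ((toWD (q.comp dh), q (dh xb)) : WeakDual ℝ X × ℝ) ∈ L := by
          refine ⟨fun v hv => ?_, rfl⟩
          change q (dh v) = 0
          rw [hv, map_zero]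
        have h1 := (hfL _ hmemL).trans_eq (hds _ _)
        change 0 ≤ q (dh d) + s * q (dh xb) at h1
        simpa using h1
      have hdh : dh (d + s • xb) = 0 := by
        refine (SeparatingDual.eq_zero_iff_forall_dual_eq_zero (R := ℝ) _).2 fun q => ?_
        have h1 := hq q
        have h2 := hq (-q)
        rw [_root_.neg_apply] at h2
        linarith
      set e : X := -(d + s • xb) with he
      have hdhe : dh e = 0 := by rw [he, map_neg, hdh, neg_zero]
      have hpe : 0 < p e := by
        have : p e = -(p d + s * p xb) := by simp [he]
        rw [this]; linarith
      have hge : ∀ t, dg t e ≤ s * (-g t xb) := by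
        intro t
        have : dg t e = -(dg t d + s * dg t xb) := by simp [he]
        have := hfK t
        linarith
      set c : ℝ := max s 1 with hc
      have hc1 : 1 ≤ c := le_max_right _ _
      have hc0 : 0 < c := by linarith
      have hfin := hlin (c⁻¹ • e) (by simp [hdhe]) (by
        intro t
        have h1 := hge t
        have h2 : s * (-g t xb) ≤ c * (-g t xb) :=
          mul_le_mul_of_nonneg_right (le_max_left _ _) (by have := hb t; linarith)
        have h3 : c⁻¹ * dg t e ≤ c⁻¹ * (c * (-g t xb)) :=
          mul_le_mul_of_nonneg_left (h1.trans h2) (by positivity)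
        rw [inv_mul_cancel_left₀ hc0.ne'] at h3
        rw [map_smul, smul_eq_mul]; linarith)
      rw [map_smul, smul_eq_mul] at hfin
      have : 0 < c⁻¹ * p e := by positivity
      linarith
    obtain ⟨_, ⟨k, hk, rfl⟩, l, ⟨hl1, hl2⟩, hkl⟩ := hmem
    have hact : coneHull S ⊆ {k | 0 ≤ k.2 - k.1 xb ∧
        (k.2 - k.1 xb = 0 → k.1 ∈ coneHull (dg '' {t : T | g t xb = 0}))} := by
      refine coneHull_subset ?_ ?_ ?_ ?_
      · exact ⟨by simp, fun _ => coneHull_zero _⟩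
      · rintro x y ⟨h1, h2⟩ ⟨h3, h4⟩
        have e1 : (x + y).2 - (x + y).1 xb = (x.2 - x.1 xb) + (y.2 - y.1 xb) := by
          simp only [Prod.snd_add, Prod.fst_add, _root_.add_apply]; ring
        refine ⟨by rw [e1]; exact add_nonneg h1 h3, fun h0 => ?_⟩
        rw [e1] at h0
        exact coneHull_add (h2 (by linarith)) (h4 (by linarith))
      · rintro a x ha ⟨h1, h2⟩
        have e1 : (a • x).2 - (a • x).1 xb = a * (x.2 - x.1 xb) := by
          simp only [Prod.smul_snd, Prod.smul_fst, _root_.smul_apply, smul_eq_mul]; ring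
        refine ⟨by rw [e1]; exact mul_nonneg ha h1, fun h0 => ?_⟩
        rw [e1] at h0
        rcases mul_eq_zero.1 h0 with h0 | h0
        · rw [h0, zero_smul]; exact coneHull_zero _
        · exact coneHull_smul ha (h2 h0)
      · rintro _ ⟨t, rfl⟩
        have := hb t
        refine ⟨?_, fun h0 => coneHull_self ⟨t, ?_, rfl⟩⟩
        · change 0 ≤ dg t xb - g t xb - dg t xb
          linarith
        · change dg t xb - g t xb - dg t xb = 0 at h0
          change g t xb = 0
          linarith
    have e1 : ∀ v, p v = k.1 v + l.1 v := fun v =>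
      (DFunLike.congr_fun (congrArg Prod.fst hkl) v).symm
    have e2 : p xb = k.2 + l.2 := (congrArg Prod.snd hkl).symm
    have hk0 : k.2 - k.1 xb = 0 := by
      have := e1 xb
      linarith
    obtain ⟨q, hq⟩ := adj_mem dh hsurj (WeakDual.toStrongDual l.1) hl1
    refine ⟨k.1, (hact hk).2 hk0, q.comp dh, ⟨q, rfl⟩, ?_⟩
    ext v
    change k.1 v + (q.comp dh) v = p v
    rw [hq]
    exact (e1 v).symm
  · rintro _ ⟨a, ha, _, ⟨q, rfl⟩, rfl⟩
    refine fn_add _ _ _ _ ?_ ?_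
    · refine coneHull_subset (fn_zero _ _) (fn_add _ _) (fn_smul _ _) ?_ ha
      rintro _ ⟨t, ht, rfl⟩
      refine fn_of_littleO _ _ (g t) _ (hgd t) fun u hu => ?_
      have ht' : g t xb = 0 := ht
      rw [ht']
      exact hu.2 t
    · refine fn_of_littleO _ _ (fun x => q (h x)) _ (q.hasFDerivAt.comp xb hhd.hasFDerivAt)
        fun u hu => ?_
      simp only [hu.1, hxb.1]
      exact le_refl _
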